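/- arXiv:2511.10181 — 2 statements merged into one kernel-verified Lean document; each statement's English description precedes it below -/
import Mathlib

section
/- Let θ₀ > 0, τ₀ := inf{t ∈ ℕ : S_{0,t} ≥ θ₀}, and c₀ := max_{x∈𝒳} |log(p₀*(x)/q₀*(x))|. Under any adaptive adversary strategy for H₀ (law ℙ), for every integer i such that (i−1)·D(p₀*‖q₀*) > θ₀, one has ℙ[τ₀ ≥ i] ≤ exp( −(i−1)·(D(p₀*‖q₀*) − θ₀/(i−1))² / (8c₀²) ). -/
open scoped BigOperators ENNReal

variable {𝒳 : Type*}

/-- A probability mass function on the finite alphabet `𝒳`. -/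
def IsDist [Fintype 𝒳] (f : 𝒳 → ℝ) : Prop :=
  (∀ x, 0 ≤ f x) ∧ ∑ x, f x = 1

/-- Kullback–Leibler divergence `D(p‖q) = ∑ₓ p(x) log (p(x)/q(x))`. -/
noncomputable def KL [Fintype 𝒳] (p q : 𝒳 → ℝ) : ℝ :=
  ∑ x, p x * Real.log (p x / q x)

/-- Probability of observing the finite sequence `l` under the adaptive strategy `str`:
`ℙ(x^t) = ∏ᵢ str(x^{i-1})(xᵢ)`. -/
noncomputable def seqProb [Fintype 𝒳] (str : List 𝒳 → 𝒳 → ℝ) (l : List 𝒳) : ℝ :=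
  ∏ i : Fin l.length, str (l.take i.1) (l.get i)

/-- Log-likelihood-ratio sum `S_t = ∑ᵢ log (p(xᵢ)/q(xᵢ))`. -/
noncomputable def llSum (p q : 𝒳 → ℝ) (l : List 𝒳) : ℝ :=
  ∑ i : Fin l.length, Real.log (p (l.get i) / q (l.get i))

/-- An adaptive adversary strategy choosing, after each history, a distribution in `P`. -/
def IsStrategy (P : Set (𝒳 → ℝ)) (str : List 𝒳 → 𝒳 → ℝ) : Prop :=
  ∀ l, str l ∈ P

open Classical in
/-- Probability that the first `n` observations form a sequence satisfying `E`. -/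
noncomputable def probAt [Fintype 𝒳] (str : List 𝒳 → 𝒳 → ℝ) (n : ℕ)
    (E : List 𝒳 → Prop) : ℝ :=
  ∑ x : Fin n → 𝒳, if E (List.ofFn x) then seqProb str (List.ofFn x) else 0

/-- No prefix of `l` (including `l` itself) lies in the stopping region `B`;
for `l` of length `n` this is the event `{τ_B > n}`. -/
def notYet (B : List 𝒳 → Prop) (l : List 𝒳) : Prop :=
  ∀ t ≤ l.length, ¬ B (l.take t)

/-- `l` is a stopped sequence of the first-hitting time `τ_B` of the region `B`. -/
def stopsAt (B : List 𝒳 → Prop) (l : List 𝒳) : Prop :=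
  B l ∧ ∀ t < l.length, ¬ B (l.take t)

/-- Expected stopping time `E[τ_B] = ∑_{n ≥ 0} ℙ(τ_B > n)`, valued in `ℝ≥0∞`. -/
noncomputable def expTau [Fintype 𝒳] (str : List 𝒳 → 𝒳 → ℝ) (B : List 𝒳 → Prop) : ℝ≥0∞ :=
  ∑' n : ℕ, ENNReal.ofReal (probAt str n (notYet B))

open Classical in
/-- Expectation of `f` evaluated at the stopped sequence `X^{τ_B}`. -/
noncomputable def expStopped [Fintype 𝒳] (str : List 𝒳 → 𝒳 → ℝ) (B : List 𝒳 → Prop)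
    (f : List 𝒳 → ℝ) : ℝ :=
  ∑' l : List 𝒳, if stopsAt B l then seqProb str l * f l else 0

open Classical in
/-- Probability that the process stops (via `B`) at a sequence satisfying `E`. -/
noncomputable def probStopIn [Fintype 𝒳] (str : List 𝒳 → 𝒳 → ℝ) (B : List 𝒳 → Prop)
    (E : List 𝒳 → Prop) : ℝ :=
  ∑' l : List 𝒳, if stopsAt B l ∧ E l then seqProb str l else 0

lemma seqProb_append_singleton [Fintype 𝒳] (str : List 𝒳 → 𝒳 → ℝ) (l : List 𝒳) (a : 𝒳) :
    seqProb str (l ++ [a]) = seqProb str l * str l a := by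
  have h : l.length + 1 = (l ++ [a]).length := by simp
  unfold seqProb
  rw [← Fin.prod_congr' _ h, Fin.prod_univ_castSucc]
  simp [List.take_append_of_le_length]

lemma llSum_append_singleton (p q : 𝒳 → ℝ) (l : List 𝒳) (a : 𝒳) :
    llSum p q (l ++ [a]) = llSum p q l + Real.log (p a / q a) := by
  have h : l.length + 1 = (l ++ [a]).length := by simp
  unfold llSum
  rw [← Fin.sum_congr' _ h, Fin.sum_univ_castSucc]
  simp

lemma sum_ofFn_succ [Fintype 𝒳] (n : ℕ) (F : List 𝒳 → ℝ) :
    ∑ x : Fin (n + 1) → 𝒳, F (List.ofFn x) =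
      ∑ x : Fin n → 𝒳, ∑ a, F (List.ofFn x ++ [a]) := by
  rw [← (Fin.snocEquiv fun _ => 𝒳).sum_comp, Fintype.sum_prod_type, Finset.sum_comm]
  refine Finset.sum_congr rfl fun x _ => Finset.sum_congr rfl fun a _ => ?_
  rw [List.ofFn_succ_last]
  simp [Fin.snocEquiv]

lemma seqProb_nonneg [Fintype 𝒳] {str : List 𝒳 → 𝒳 → ℝ} (h : ∀ l, IsDist (str l))
    (l : List 𝒳) : 0 ≤ seqProb str l :=
  Finset.prod_nonneg fun _ _ => (h _).1 _

/-- Gibbs' inequality. -/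
lemma KL_nonneg [Fintype 𝒳] {p q : 𝒳 → ℝ} (hp : IsDist p) (hq : IsDist q)
    (hpq : ∀ x, p x = 0 ↔ q x = 0) : 0 ≤ KL p q := by
  have h : ∑ x, (p x - q x) ≤ KL p q := by
    refine Finset.sum_le_sum fun x _ => ?_
    rcases eq_or_lt_of_le (hp.1 x) with h0 | hpx
    · simp [← h0, (hpq x).1 h0.symm]
    · have hqx : 0 < q x := lt_of_le_of_ne (hq.1 x) fun h => hpx.ne' ((hpq x).2 h.symm)
      have hlog := Real.one_sub_inv_le_log_of_pos (div_pos hpx hqx)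
      have := mul_le_mul_of_nonneg_left hlog hpx.le
      have e : p x * (1 - (p x / q x)⁻¹) = p x - q x := by field_simp
      linarith
  rwa [Finset.sum_sub_distrib, hp.2, hq.2, sub_self] at h

/-- The divergence along a segment is bounded by its first-order expansion at the left end point
plus a quadratic term. -/
lemma KL_segment_le [Fintype 𝒳] {p p₀ q₀ : 𝒳 → ℝ} (hp : IsDist p) (hp₀ : IsDist p₀)
    (hq₀ : IsDist q₀) (h₀ : ∀ x, p₀ x = 0 ↔ q₀ x = 0) (h : ∀ x, p x = 0 ↔ q₀ x = 0)
    {t : ℝ} (ht₀ : 0 < t) (ht₁ : t < 1) :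
    KL (fun x => (1 - t) * p₀ x + t * p x) q₀ ≤
      KL p₀ q₀ + t * (∑ x, p x * Real.log (p₀ x / q₀ x) - KL p₀ q₀) +
        t ^ 2 * ∑ x, (p x - p₀ x) ^ 2 / p₀ x := by
  have key : KL (fun x => (1 - t) * p₀ x + t * p x) q₀ ≤
      ∑ x, (p₀ x * Real.log (p₀ x / q₀ x) +
        t * (p x * Real.log (p₀ x / q₀ x) - p₀ x * Real.log (p₀ x / q₀ x)) +
        t ^ 2 * ((p x - p₀ x) ^ 2 / p₀ x) + t * (p x - p₀ x)) := by
    refine Finset.sum_le_sum fun x _ => ?_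
    rcases eq_or_lt_of_le (hp₀.1 x) with h0 | hp₀x
    · simp [← h0, (h x).2 ((h₀ x).1 h0.symm)]
    · have hq₀x : 0 < q₀ x := lt_of_le_of_ne (hq₀.1 x) fun h => hp₀x.ne' ((h₀ x).2 h.symm)
      have hr : 0 < (1 - t) * p₀ x + t * p x :=
        add_pos_of_pos_of_nonneg (mul_pos (by linarith) hp₀x) (mul_nonneg ht₀.le (hp.1 x))
      have hlog : Real.log (((1 - t) * p₀ x + t * p x) / q₀ x) ≤
          Real.log (p₀ x / q₀ x) + (((1 - t) * p₀ x + t * p x) / p₀ x - 1) := by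
        have := Real.log_le_sub_one_of_pos (div_pos hr hp₀x)
        rw [Real.log_div hr.ne' hp₀x.ne'] at this
        rw [Real.log_div hr.ne' hq₀x.ne', Real.log_div hp₀x.ne' hq₀x.ne']
        linarith
      refine (mul_le_mul_of_nonneg_left hlog hr.le).trans_eq ?_
      field_simp
      ring
  refine key.trans_eq ?_
  simp only [Finset.sum_add_distrib, ← Finset.mul_sum, Finset.sum_sub_distrib, hp.2, hp₀.2, KL]
  ring

/-- If `p₀` minimises the divergence from `q₀` over a convex set, the expected log-likelihood ratio
under any element of the set is at least the minimal divergence. -/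
lemma KL_le_sum_mul_log [Fintype 𝒳] {P : Set (𝒳 → ℝ)} (hP : ∀ p ∈ P, IsDist p)
    (hPconv : Convex ℝ P) {p p₀ q₀ : 𝒳 → ℝ} (hp : p ∈ P) (hp₀ : p₀ ∈ P) (hq₀ : IsDist q₀)
    (hac : ∀ p ∈ P, ∀ x, p x = 0 ↔ q₀ x = 0) (hmin : ∀ p ∈ P, KL p₀ q₀ ≤ KL p q₀) :
    KL p₀ q₀ ≤ ∑ x, p x * Real.log (p₀ x / q₀ x) := by
  set B := ∑ x, (p x - p₀ x) ^ 2 / p₀ x with hB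
  set A := ∑ x, p x * Real.log (p₀ x / q₀ x) - KL p₀ q₀ with hA
  have hB0 : 0 ≤ B := Finset.sum_nonneg fun x _ => div_nonneg (sq_nonneg _) ((hP _ hp₀).1 x)
  by_contra! hlt
  have hA0 : A < 0 := by linarith
  have hden : 0 < 2 * (B - A) := by linarith
  obtain ⟨t, ht⟩ : ∃ t, t = -A / (2 * (B - A)) := ⟨_, rfl⟩
  have htA : t * (2 * (B - A)) = -A := by rw [ht, div_mul_cancel₀ _ hden.ne']
  have ht₀ : 0 < t := ht ▸ div_pos (by linarith) hden
  have ht₁ : t < 1 := by rw [ht, div_lt_one hden]; linarith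
  have hmem : (fun x => (1 - t) * p₀ x + t * p x) ∈ P :=
    hPconv hp₀ hp (by linarith : (0 : ℝ) ≤ 1 - t) ht₀.le (by ring)
  have hle := (hmin _ hmem).trans
    (KL_segment_le (hP _ hp) (hP _ hp₀) hq₀ (hac _ hp₀) (hac _ hp) ht₀ ht₁)
  rw [← hA, ← hB] at hle
  have hpos : 0 ≤ t * (A + t * B) := by linarith
  have : 0 ≤ A + t * B := nonneg_of_mul_nonneg_right hpos ht₀
  have : t * A < 0 := mul_neg_of_pos_of_neg ht₀ hA0
  linarith

/-- One-step exponential moment bound for a bounded variable whose mean is at least `D`. -/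
lemma sum_mul_exp_le [Fintype 𝒳] {p L : 𝒳 → ℝ} (hp : IsDist p) {c D s : ℝ} (hc : 0 < c)
    (hL : ∀ x, |L x| ≤ c) (hD : |D| ≤ c) (hmean : D ≤ ∑ x, p x * L x) (hs : 0 ≤ s) :
    ∑ x, p x * Real.exp (-s * (L x - D)) ≤ Real.exp (2 * s ^ 2 * c ^ 2) := by
  have hpt : ∀ x, Real.exp (-s * (L x - D)) ≤
      Real.cosh (2 * s * c) + (D - L x) / (2 * c) * Real.sinh (2 * s * c) := fun x => by
    have ht : |(D - L x) / (2 * c)| ≤ 1 := by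
      rw [abs_div, abs_of_pos (by positivity : 0 < 2 * c), div_le_one (by positivity)]
      linarith [abs_sub D (L x), hL x]
    refine le_trans (le_of_eq ?_) (Real.exp_mul_le_cosh_add_mul_sinh ht _)
    congr 1
    field_simp
    ring
  calc ∑ x, p x * Real.exp (-s * (L x - D))
      ≤ ∑ x, p x * (Real.cosh (2 * s * c) + (D - L x) / (2 * c) * Real.sinh (2 * s * c)) :=
        Finset.sum_le_sum fun x _ => mul_le_mul_of_nonneg_left (hpt x) (hp.1 x)
    _ = ∑ x, (p x * (Real.cosh (2 * s * c) + D * (Real.sinh (2 * s * c) / (2 * c))) -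
          p x * L x * (Real.sinh (2 * s * c) / (2 * c))) :=
        Finset.sum_congr rfl fun x _ => by ring
    _ = Real.cosh (2 * s * c) +
          (D - ∑ x, p x * L x) * (Real.sinh (2 * s * c) / (2 * c)) := by
        rw [Finset.sum_sub_distrib, ← Finset.sum_mul, ← Finset.sum_mul, hp.2]
        ring
    _ ≤ Real.cosh (2 * s * c) := by
        have : 0 ≤ Real.sinh (2 * s * c) / (2 * c) :=
          div_nonneg (Real.sinh_nonneg_iff.2 (by positivity)) (by positivity)
        linarith [mul_nonneg (sub_nonneg.2 hmean) this]
    _ ≤ Real.exp ((2 * s * c) ^ 2 / 2) := Real.cosh_le_exp_half_sq _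
    _ = Real.exp (2 * s ^ 2 * c ^ 2) := by ring_nf

/-- Exponential moment bound for the log-likelihood-ratio sum under an adaptive strategy. -/
lemma sum_seqProb_mul_exp_le [Fintype 𝒳] {str : List 𝒳 → 𝒳 → ℝ} (hstr : ∀ l, IsDist (str l))
    {p q : 𝒳 → ℝ} {c D s : ℝ} (hc : 0 < c) (hL : ∀ x, |Real.log (p x / q x)| ≤ c)
    (hD : |D| ≤ c) (hmean : ∀ l, D ≤ ∑ x, str l x * Real.log (p x / q x)) (hs : 0 ≤ s) (n : ℕ) :
    ∑ x : Fin n → 𝒳, seqProb str (List.ofFn x) *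
      Real.exp (-s * (llSum p q (List.ofFn x) - n * D)) ≤ Real.exp (n * (2 * s ^ 2 * c ^ 2)) := by
  induction n with
  | zero =>
    have h₁ : seqProb str [] = 1 := Fin.prod_univ_zero _
    have h₂ : llSum p q [] = 0 := Fin.sum_univ_zero _
    simp [h₁, h₂]
  | succ n ih =>
    rw [sum_ofFn_succ n fun l => seqProb str l * Real.exp (-s * (llSum p q l - (n + 1 : ℕ) * D))]
    calc _ = ∑ x : Fin n → 𝒳, seqProb str (List.ofFn x) *
            Real.exp (-s * (llSum p q (List.ofFn x) - n * D)) *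
            ∑ a, str (List.ofFn x) a * Real.exp (-s * (Real.log (p a / q a) - D)) := by
          refine Finset.sum_congr rfl fun x _ => ?_
          rw [Finset.mul_sum]
          refine Finset.sum_congr rfl fun a _ => ?_
          rw [seqProb_append_singleton, llSum_append_singleton, mul_mul_mul_comm, ← Real.exp_add]
          congr 2
          push_cast
          ring
      _ ≤ ∑ x : Fin n → 𝒳, seqProb str (List.ofFn x) *
            Real.exp (-s * (llSum p q (List.ofFn x) - n * D)) *
            Real.exp (2 * s ^ 2 * c ^ 2) :=
          Finset.sum_le_sum fun x _ => mul_le_mul_of_nonneg_left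
            (sum_mul_exp_le (hstr _) hc hL hD (hmean _) hs)
            (mul_nonneg (seqProb_nonneg hstr _) (Real.exp_nonneg _))
      _ ≤ Real.exp (n * (2 * s ^ 2 * c ^ 2)) * Real.exp (2 * s ^ 2 * c ^ 2) := by
          rw [← Finset.sum_mul]
          exact mul_le_mul_of_nonneg_right ih (Real.exp_nonneg _)
      _ = _ := by
          rw [← Real.exp_add]
          congr 1
          push_cast
          ring

/-- Chernoff bound for the event that the log-likelihood-ratio sum has not yet reached `θ`. -/
lemma probAt_notYet_le [Fintype 𝒳] {str : List 𝒳 → 𝒳 → ℝ} (hstr : ∀ l, IsDist (str l))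
    {p q : 𝒳 → ℝ} {c D s : ℝ} (hc : 0 < c) (hL : ∀ x, |Real.log (p x / q x)| ≤ c)
    (hD : |D| ≤ c) (hmean : ∀ l, D ≤ ∑ x, str l x * Real.log (p x / q x)) (hs : 0 ≤ s) (n : ℕ)
    (θ : ℝ) :
    probAt str n (notYet fun l => θ ≤ llSum p q l) ≤
      Real.exp (n * (2 * s ^ 2 * c ^ 2) - s * (n * D - θ)) := by
  have hle : probAt str n (notYet fun l => θ ≤ llSum p q l) ≤
      ∑ x : Fin n → 𝒳, seqProb str (List.ofFn x) *
        Real.exp (-s * (llSum p q (List.ofFn x) - n * D)) * Real.exp (-(s * (n * D - θ))) := by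
    refine Finset.sum_le_sum fun x _ => ?_
    have h0 := seqProb_nonneg hstr (List.ofFn x)
    split_ifs with hx
    · have hlt : llSum p q (List.ofFn x) < θ := by
        have := hx _ le_rfl
        rwa [List.take_length, not_le] at this
      rw [mul_assoc, ← Real.exp_add]
      refine le_mul_of_one_le_right h0 (Real.one_le_exp ?_)
      linarith [mul_nonneg hs (sub_nonneg.2 hlt.le)]
    · positivity
  refine hle.trans ?_
  rw [← Finset.sum_mul, sub_eq_add_neg _ (s * _), Real.exp_add]
  exact mul_le_mul_of_nonneg_right (sum_seqProb_mul_exp_le hstr hc hL hD hmean hs n)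
    (Real.exp_nonneg _)

/-- For `θ₀ > 0`, `τ₀ = inf{t : S_{0,t} ≥ θ₀}` and
`c₀ = max_x |log (p₀*(x)/q₀*(x))|`: under any adaptive adversary strategy for `H₀` (law `ℙ`),
for every integer `i` with `(i−1)·D(p₀*‖q₀*) > θ₀`,
`ℙ[τ₀ ≥ i] ≤ exp(−(i−1)(D(p₀*‖q₀*) − θ₀/(i−1))² / (8c₀²))`. -/
theorem stmt6 [Fintype 𝒳] [Nonempty 𝒳]
    (P Q : Set (𝒳 → ℝ))
    (hP : ∀ p ∈ P, IsDist p) (hQ : ∀ q ∈ Q, IsDist q)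
    (hPclosed : IsClosed P) (hQclosed : IsClosed Q)
    (hPconv : Convex ℝ P) (hQconv : Convex ℝ Q)
    (hdisj : Disjoint P Q)
    (hac : ∀ p ∈ P, ∀ q ∈ Q, ∀ x, (p x = 0 ↔ q x = 0))
    (p₀ q₀ : 𝒳 → ℝ) (hp₀ : p₀ ∈ P) (hq₀ : q₀ ∈ Q)
    (hmin₀ : ∀ p ∈ P, ∀ q ∈ Q, KL p₀ q₀ ≤ KL p q)
    (strP : List 𝒳 → 𝒳 → ℝ) (hstrP : IsStrategy P strP)
    (θ₀ : ℝ) (hθ₀ : 0 < θ₀)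
    (c₀ : ℝ) (hc₀ : c₀ = ⨆ x, |Real.log (p₀ x / q₀ x)|)
    (i : ℕ) (hi : θ₀ < ((i : ℝ) - 1) * KL p₀ q₀) :
    probAt strP (i - 1) (notYet (fun l => θ₀ ≤ llSum p₀ q₀ l)) ≤
      Real.exp (-(((i : ℝ) - 1) * (KL p₀ q₀ - θ₀ / ((i : ℝ) - 1)) ^ 2 / (8 * c₀ ^ 2))) := by
  have hac₀ : ∀ p ∈ P, ∀ x, p x = 0 ↔ q₀ x = 0 := fun p hp => hac p hp q₀ hq₀
  have hD0 : 0 ≤ KL p₀ q₀ := KL_nonneg (hP _ hp₀) (hQ _ hq₀) (hac₀ _ hp₀)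
  have hi1 : 0 < (i : ℝ) - 1 := pos_of_mul_pos_left (hθ₀.trans hi) hD0
  have hDpos : 0 < KL p₀ q₀ := pos_of_mul_pos_right (hθ₀.trans hi) hi1.le
  have hL : ∀ x, |Real.log (p₀ x / q₀ x)| ≤ c₀ := fun x =>
    hc₀ ▸ le_ciSup (f := fun x => |Real.log (p₀ x / q₀ x)|) (Set.finite_range _).bddAbove x
  have hDc : KL p₀ q₀ ≤ c₀ := by
    calc KL p₀ q₀ ≤ ∑ x, p₀ x * c₀ := Finset.sum_le_sum fun x _ =>
          mul_le_mul_of_nonneg_left ((le_abs_self _).trans (hL x)) ((hP _ hp₀).1 x)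
      _ = c₀ := by rw [← Finset.sum_mul, (hP _ hp₀).2, one_mul]
  have hc : 0 < c₀ := hDpos.trans_le hDc
  have hcast : ((i - 1 : ℕ) : ℝ) = (i : ℝ) - 1 := by
    rw [Nat.cast_sub, Nat.cast_one]
    exact_mod_cast (sub_pos.1 hi1).le
  have hδ : 0 ≤ KL p₀ q₀ - θ₀ / ((i : ℝ) - 1) := by
    rw [sub_nonneg, div_le_iff₀ hi1]
    linarith
  refine (probAt_notYet_le (fun l => hP _ (hstrP l)) hc hL (by rwa [abs_of_nonneg hD0])
    (fun l => KL_le_sum_mul_log hP hPconv (hstrP l) hp₀ (hQ _ hq₀) hac₀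
      fun p hp => hmin₀ p hp q₀ hq₀)
    (s := (KL p₀ q₀ - θ₀ / ((i : ℝ) - 1)) / (4 * c₀ ^ 2)) (by positivity) _ _).trans_eq ?_
  rw [hcast]
  congr 1
  field_simp
  ring
end

section
/- Fix α₀, α₁ > 0 and n ∈ ℕ. Consider the sequential test with stopping time τ_n := inf{t ∈ ℕ : S_{0,t} ≥ α₀ n or S_{1,t} ≥ α₁ n} which decides H₁ exactly when S_{1,τ_n} ≥ α₁ n (its type-I error event is E = {S_{1,τ_n} ≥ α₁ n}). Then for every adaptive adversary strategy for H₀ (law ℙ), the type-I error satisfies π_{1|0} = ℙ(E) ≤ 2^{−α₁ n}. Symmetrically, for every adaptive adversary strategy for H₁ (law ℚ), the type-II error satisfies π_{0|1} = ℚ(S_{0,τ_n} ≥ α₀ n, S_{1,τ_n} < α₁ n) ≤ ℚ(S_{0,τ_n} ≥ α₀ n) ≤ 2^{−α₀ n}. -/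
open scoped BigOperators ENNReal

variable {𝒳 : Type*}

/-- Kullback–Leibler divergence with base-2 logarithms. -/
noncomputable def KL2 [Fintype 𝒳] (p q : 𝒳 → ℝ) : ℝ :=
  ∑ x, p x * Real.logb 2 (p x / q x)

/-- Log-likelihood-ratio sum `S_t` with base-2 logarithms. -/
noncomputable def llSum2 (p q : 𝒳 → ℝ) (l : List 𝒳) : ℝ :=
  ∑ i : Fin l.length, Real.logb 2 (p (l.get i) / q (l.get i))

open Filter Topology

theorem seqProb_nil [Fintype 𝒳] (f : List 𝒳 → 𝒳 → ℝ) : seqProb f [] = 1 :=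
  Fin.prod_univ_zero _

theorem seqProb_cons [Fintype 𝒳] (f : List 𝒳 → 𝒳 → ℝ) (x : 𝒳) (l : List 𝒳) :
    seqProb f (x :: l) = f [] x * seqProb (fun m => f (x :: m)) l :=
  Fin.prod_univ_succ (n := l.length)
    (fun i => f ((x :: l).take i.1) ((x :: l).get i))

theorem seqProb_nonneg_s10 [Fintype 𝒳] {f : List 𝒳 → 𝒳 → ℝ} (hf : ∀ l x, 0 ≤ f l x)
    (l : List 𝒳) : 0 ≤ seqProb f l :=
  Finset.prod_nonneg fun _ _ => hf _ _

/-- Kraft's inequality for a finite prefix-free family, weighted by a sub-stochastic tree. -/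
theorem sum_seqProb_le_one_of_prefix_free [Fintype 𝒳] (N : ℕ) :
    ∀ (f : List 𝒳 → 𝒳 → ℝ) (F : Finset (List 𝒳)), (∀ l x, 0 ≤ f l x) →
      (∀ l, ∑ x, f l x ≤ 1) → (∀ l ∈ F, l.length ≤ N) →
      (∀ l ∈ F, ∀ m ∈ F, l <+: m → l = m) → ∑ l ∈ F, seqProb f l ≤ 1 := by
  classical
  induction N with
  | zero =>
    intro f F _ _ hN _
    have hF : F ⊆ {[]} := fun l hl => by simpa using hN l hl
    calc ∑ l ∈ F, seqProb f l ≤ ∑ l ∈ {[]}, seqProb f l :=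
          Finset.sum_le_sum_of_subset_of_nonneg hF fun l hl _ => by
            rw [Finset.mem_singleton.1 hl, seqProb_nil]; exact zero_le_one
      _ = 1 := by rw [Finset.sum_singleton, seqProb_nil]
  | succ N ih =>
    intro f F hf hsum hN hpre
    by_cases hnil : [] ∈ F
    · have hF : F = {[]} := Finset.eq_singleton_iff_unique_mem.2
        ⟨hnil, fun l hl => (hpre [] hnil l hl l.nil_prefix).symm⟩
      rw [hF, Finset.sum_singleton, seqProb_nil]
    · have hinj (x : 𝒳) : Function.Injective (List.cons x) := List.cons_injective
      let G (x : 𝒳) : Finset (List 𝒳) := F.preimage (List.cons x) (hinj x).injOn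
      have hG (x : 𝒳) (l : List 𝒳) : l ∈ G x ↔ x :: l ∈ F := Finset.mem_preimage
      have hsplit : ∑ l ∈ F, seqProb f l = ∑ x, ∑ l ∈ G x, seqProb f (x :: l) := by
        rw [Finset.sum_sigma']
        symm
        refine Finset.sum_bij (fun a _ => a.1 :: a.2) ?_ ?_ ?_ ?_
        · rintro ⟨x, l⟩ h
          exact (hG x l).1 (Finset.mem_sigma.1 h).2
        · rintro ⟨x, l⟩ _ ⟨y, m⟩ _ h
          obtain ⟨rfl, rfl⟩ := List.cons.inj h
          rfl
        · rintro (_ | ⟨x, l⟩) h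
          · exact absurd h hnil
          · exact ⟨⟨x, l⟩, Finset.mem_sigma.2 ⟨Finset.mem_univ _, (hG x l).2 h⟩, rfl⟩
        · intro _ _; rfl
      calc ∑ l ∈ F, seqProb f l
          = ∑ x, f [] x * ∑ l ∈ G x, seqProb (fun m => f (x :: m)) l := by
            simp only [hsplit, seqProb_cons, Finset.mul_sum]
        _ ≤ ∑ x, f [] x := Finset.sum_le_sum fun x _ =>
            mul_le_of_le_one_right (hf _ _) <| ih _ _ (fun _ _ => hf _ _) (fun _ => hsum _)
              (fun l hl => by simpa using hN _ ((hG x l).1 hl))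
              (fun l hl m hm h => hinj x <| hpre _ ((hG x l).1 hl) _ ((hG x m).1 hm)
                ((List.prefix_cons_inj x).2 h))
        _ ≤ 1 := hsum []

theorem stopsAt.eq_of_prefix {B : List 𝒳 → Prop} {l m : List 𝒳} (hl : stopsAt B l)
    (hm : stopsAt B m) (h : l <+: m) : l = m := by
  refine h.eq_of_length (le_antisymm h.length_le (not_lt.1 fun hlt => ?_))
  exact hm.2 _ hlt (List.prefix_iff_eq_take.1 h ▸ hl.1)

theorem sum_seqProb_stopsAt_le_one [Fintype 𝒳] {f : List 𝒳 → 𝒳 → ℝ}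
    (hf : ∀ l x, 0 ≤ f l x) (hsum : ∀ l, ∑ x, f l x ≤ 1) (B : List 𝒳 → Prop)
    {F : Finset (List 𝒳)} (hF : ∀ l ∈ F, stopsAt B l) : ∑ l ∈ F, seqProb f l ≤ 1 :=
  sum_seqProb_le_one_of_prefix_free (F.sup List.length) f F hf hsum
    (fun _ hl => Finset.le_sup (f := List.length) hl)
    (fun _ hl _ hm => (hF _ hl).eq_of_prefix (hF _ hm))

open Classical in
theorem probStopIn_mono [Fintype 𝒳] {str : List 𝒳 → 𝒳 → ℝ} (h0 : ∀ l x, 0 ≤ str l x)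
    (h1 : ∀ l, ∑ x, str l x ≤ 1) (B : List 𝒳 → Prop) {E E' : List 𝒳 → Prop}
    (h : ∀ l, E l → E' l) : probStopIn str B E ≤ probStopIn str B E' := by
  have hs (E : List 𝒳 → Prop) :
      Summable fun l => if stopsAt B l ∧ E l then seqProb str l else 0 := by
    refine summable_of_sum_le (c := 1) (fun l => ?_) fun F => ?_
    · exact ite_nonneg (seqProb_nonneg_s10 h0 l) le_rfl
    · rw [← Finset.sum_filter]
      exact sum_seqProb_stopsAt_le_one h0 h1 B fun l hl => (Finset.mem_filter.1 hl).2.1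
  refine (hs E).tsum_le_tsum (fun l => ?_) (hs E')
  by_cases hE : stopsAt B l ∧ E l
  · rw [if_pos hE, if_pos ⟨hE.1, h l hE.2⟩]
  · rw [if_neg hE]
    exact ite_nonneg (seqProb_nonneg_s10 h0 l) le_rfl

theorem seqProb_mul_rpow_logb [Fintype 𝒳] (str : List 𝒳 → 𝒳 → ℝ) (p q : 𝒳 → ℝ)
    (l : List 𝒳) :
    seqProb (fun m x => str m x * (2 : ℝ) ^ Real.logb 2 (p x / q x)) l =
      seqProb str l * (2 : ℝ) ^ llSum2 p q l := by
  simp only [seqProb, llSum2, Finset.prod_mul_distrib]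
  rw [Real.rpow_sum_of_pos two_pos]

/-- Ville-type bound: if the likelihood ratio is a one-step supermartingale factor under `str`,
its logarithm exceeds `c` at the stopping time with probability at most `2 ^ (-c)`. -/
theorem probStopIn_le_rpow_neg [Fintype 𝒳] {str : List 𝒳 → 𝒳 → ℝ}
    (h0 : ∀ l x, 0 ≤ str l x) (p q : 𝒳 → ℝ)
    (h1 : ∀ l, ∑ x, str l x * (2 : ℝ) ^ Real.logb 2 (p x / q x) ≤ 1)
    (B : List 𝒳 → Prop) (c : ℝ) :
    probStopIn str B (fun l => c ≤ llSum2 p q l) ≤ (2 : ℝ) ^ (-c) := by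
  classical
  refine Real.tsum_le_of_sum_le (fun l => ?_) fun F => ?_
  · exact ite_nonneg (seqProb_nonneg_s10 h0 l) le_rfl
  · rw [← Finset.sum_filter]
    have hmem {l : List 𝒳} (hl : l ∈ F.filter fun l => stopsAt B l ∧ c ≤ llSum2 p q l) :=
      (Finset.mem_filter.1 hl).2
    calc ∑ l ∈ F with stopsAt B l ∧ c ≤ llSum2 p q l, seqProb str l
        ≤ ∑ l ∈ F with stopsAt B l ∧ c ≤ llSum2 p q l, (2 : ℝ) ^ (-c) *
            seqProb (fun m x => str m x * (2 : ℝ) ^ Real.logb 2 (p x / q x)) l := by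
          refine Finset.sum_le_sum fun l hl => ?_
          rw [seqProb_mul_rpow_logb, mul_left_comm, ← Real.rpow_add two_pos]
          exact le_mul_of_one_le_right (seqProb_nonneg_s10 h0 l)
            (Real.one_le_rpow one_le_two (by linarith [(hmem hl).2]))
      _ ≤ (2 : ℝ) ^ (-c) := by
          rw [← Finset.mul_sum]
          refine mul_le_of_le_one_right (by positivity) ?_
          exact sum_seqProb_stopsAt_le_one
            (fun l x => mul_nonneg (h0 l x) (by positivity)) h1 B fun l hl => (hmem hl).1

/-- First-order optimality of the reverse information projection `b` of `a` onto `K`. -/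
theorem sum_mul_div_le_one_of_KL2_minimal [Fintype 𝒳] {K : Set (𝒳 → ℝ)} (hK : Convex ℝ K)
    {a b c : 𝒳 → ℝ} (ha : IsDist a) (hb : IsDist b) (hc : IsDist c) (hbK : b ∈ K)
    (hcK : c ∈ K) (hab : ∀ x, b x = 0 ↔ a x = 0) (hmin : ∀ p ∈ K, KL2 a b ≤ KL2 a p) :
    ∑ x, c x * (a x / b x) ≤ 1 := by
  have hpos {x : 𝒳} (hx : a x ≠ 0) : 0 < b x :=
    lt_of_le_of_ne (hb.1 x) fun h => hx ((hab x).1 h.symm)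
  let m (t : ℝ) (x : 𝒳) : ℝ := (1 - t) * b x + t * c x
  have hineq (t : ℝ) (ht0 : 0 < t) (ht1 : t < 1) :
      ∑ x, a x * ((c x - b x) / m t x) ≤ 0 := by
    have hmK : m t ∈ K := hK hbK hcK (sub_nonneg.2 ht1.le) ht0.le (sub_add_cancel 1 t)
    have hmin' := sub_nonneg.2 (hmin _ hmK)
    rw [KL2, KL2, ← Finset.sum_sub_distrib] at hmin'
    have hlog : t * ∑ x, a x * ((c x - b x) / m t x) ≤
        -(Real.log 2 * ∑ x, (a x * Real.logb 2 (a x / m t x) -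
          a x * Real.logb 2 (a x / b x))) := by
      rw [Finset.mul_sum, Finset.mul_sum, ← Finset.sum_neg_distrib]
      refine Finset.sum_le_sum fun x _ => ?_
      by_cases hx : a x = 0
      · simp [hx]
      have hbx := hpos hx
      have hax : 0 < a x := lt_of_le_of_ne (ha.1 x) (Ne.symm hx)
      have hmx : 0 < m t x :=
        add_pos_of_pos_of_nonneg (mul_pos (sub_pos.2 ht1) hbx) (mul_nonneg ht0.le (hc.1 x))
      have hl := Real.one_sub_inv_le_log_of_pos (div_pos hmx hbx)
      have hlog2 : Real.log 2 ≠ 0 := (Real.log_pos one_lt_two).ne'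
      have e1 : t * (a x * ((c x - b x) / m t x)) = a x * (1 - (m t x / b x)⁻¹) := by
        have hm : m t x = (1 - t) * b x + t * c x := rfl
        rw [inv_div]
        field_simp
        rw [hm]
        ring
      have e2 : -(Real.log 2 * (a x * Real.logb 2 (a x / m t x) -
          a x * Real.logb 2 (a x / b x))) = a x * Real.log (m t x / b x) := by
        rw [Real.logb, Real.logb, Real.log_div hx hmx.ne', Real.log_div hx hbx.ne',
          Real.log_div hmx.ne' hbx.ne']
        field_simp
        ring
      rw [e1, e2]
      exact mul_le_mul_of_nonneg_left hl hax.le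
    have hneg := mul_nonneg (Real.log_pos one_lt_two).le hmin'
    exact nonpos_of_mul_nonpos_right (hlog.trans (neg_nonpos.2 hneg)) ht0
  have hlim : Tendsto (fun t => ∑ x, a x * ((c x - b x) / m t x)) (𝓝[>] 0)
      (𝓝 (∑ x, a x * ((c x - b x) / b x))) := by
    refine tendsto_finsetSum _ fun x _ => ?_
    by_cases hx : a x = 0
    · simp [hx]
    · have hm : ContinuousAt (fun t => m t x) 0 := by fun_prop
      have hm0 : m 0 x = b x := by simp [m]
      have hm' : Tendsto (fun t => m t x) (𝓝[>] 0) (𝓝 (b x)) :=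
        hm0 ▸ hm.tendsto.mono_left nhdsWithin_le_nhds
      exact (tendsto_const_nhds.div hm' (hpos hx).ne').const_mul _
  have hle : ∑ x, a x * ((c x - b x) / b x) ≤ 0 :=
    le_of_tendsto hlim <| by
      filter_upwards [Ioo_mem_nhdsGT (zero_lt_one' ℝ)] with t ht using hineq t ht.1 ht.2
  have hsum : ∑ x, a x * ((c x - b x) / b x) = ∑ x, c x * (a x / b x) - ∑ x, a x := by
    rw [← Finset.sum_sub_distrib]
    refine Finset.sum_congr rfl fun x _ => ?_
    by_cases hx : a x = 0
    · simp [hx]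
    · have := (hpos hx).ne'
      field_simp
  rw [hsum, ha.2] at hle
  linarith

theorem sum_mul_rpow_logb_le_one_of_KL2_minimal [Fintype 𝒳] {K : Set (𝒳 → ℝ)}
    (hK : Convex ℝ K) (hKd : ∀ p ∈ K, IsDist p) {a b c : 𝒳 → ℝ} (ha : IsDist a)
    (hbK : b ∈ K) (hcK : c ∈ K) (hac : ∀ p ∈ K, ∀ x, p x = 0 ↔ a x = 0)
    (hmin : ∀ p ∈ K, KL2 a b ≤ KL2 a p) :
    ∑ x, c x * (2 : ℝ) ^ Real.logb 2 (a x / b x) ≤ 1 := by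
  refine le_trans (Finset.sum_le_sum fun x _ => ?_) <|
    sum_mul_div_le_one_of_KL2_minimal hK ha (hKd b hbK) (hKd c hcK) hbK hcK (hac b hbK) hmin
  by_cases hx : a x = 0
  · simp [(hac c hcK x).2 hx]
  · have hbx : b x ≠ 0 := fun h => hx ((hac b hbK x).1 h)
    have hax : 0 < a x := lt_of_le_of_ne (ha.1 x) (Ne.symm hx)
    have hbx' : 0 < b x := lt_of_le_of_ne ((hKd b hbK).1 x) (Ne.symm hbx)
    rw [Real.rpow_logb two_pos (by norm_num) (div_pos hax hbx')]

/-- Fix `α₀, α₁ > 0` and `n`.  For the sequential test stopping at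
`τ_n = inf{t : S_{0,t} ≥ α₀n or S_{1,t} ≥ α₁n}` (base-2 logarithms) which decides `H₁`
exactly when `S_{1,τ_n} ≥ α₁n`: under every adaptive adversary strategy for `H₀` (law `ℙ`),
the type-I error satisfies `ℙ(S_{1,τ_n} ≥ α₁n) ≤ 2^{−α₁n}`; symmetrically, under every
adaptive adversary strategy for `H₁` (law `ℚ`), the type-II error satisfies
`ℚ(S_{0,τ_n} ≥ α₀n, S_{1,τ_n} < α₁n) ≤ ℚ(S_{0,τ_n} ≥ α₀n) ≤ 2^{−α₀n}`. -/
theorem stmt10 [Fintype 𝒳] [Nonempty 𝒳]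
    (P Q : Set (𝒳 → ℝ))
    (hP : ∀ p ∈ P, IsDist p) (hQ : ∀ q ∈ Q, IsDist q)
    (hPclosed : IsClosed P) (hQclosed : IsClosed Q)
    (hPconv : Convex ℝ P) (hQconv : Convex ℝ Q)
    (hdisj : Disjoint P Q)
    (hac : ∀ p ∈ P, ∀ q ∈ Q, ∀ x, (p x = 0 ↔ q x = 0))
    (p₀ q₀ : 𝒳 → ℝ) (hp₀ : p₀ ∈ P) (hq₀ : q₀ ∈ Q)
    (hmin₀ : ∀ p ∈ P, ∀ q ∈ Q, KL2 p₀ q₀ ≤ KL2 p q)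
    (p₁ q₁ : 𝒳 → ℝ) (hp₁ : p₁ ∈ P) (hq₁ : q₁ ∈ Q)
    (hmin₁ : ∀ p ∈ P, ∀ q ∈ Q, KL2 q₁ p₁ ≤ KL2 q p)
    (strP strQ : List 𝒳 → 𝒳 → ℝ)
    (hstrP : IsStrategy P strP) (hstrQ : IsStrategy Q strQ)
    (α₀ α₁ : ℝ) (hα₀ : 0 < α₀) (hα₁ : 0 < α₁) (n : ℕ) :
    probStopIn strP
        (fun l => α₀ * n ≤ llSum2 p₀ q₀ l ∨ α₁ * n ≤ llSum2 q₁ p₁ l)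
        (fun l => α₁ * n ≤ llSum2 q₁ p₁ l) ≤ (2 : ℝ) ^ (-(α₁ * n)) ∧
    probStopIn strQ
        (fun l => α₀ * n ≤ llSum2 p₀ q₀ l ∨ α₁ * n ≤ llSum2 q₁ p₁ l)
        (fun l => α₀ * n ≤ llSum2 p₀ q₀ l ∧ llSum2 q₁ p₁ l < α₁ * n) ≤
      probStopIn strQ
        (fun l => α₀ * n ≤ llSum2 p₀ q₀ l ∨ α₁ * n ≤ llSum2 q₁ p₁ l)
        (fun l => α₀ * n ≤ llSum2 p₀ q₀ l) ∧
    probStopIn strQ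
        (fun l => α₀ * n ≤ llSum2 p₀ q₀ l ∨ α₁ * n ≤ llSum2 q₁ p₁ l)
        (fun l => α₀ * n ≤ llSum2 p₀ q₀ l) ≤ (2 : ℝ) ^ (-(α₀ * n)) := by
  have hP0 (l : List 𝒳) := hP _ (hstrP l)
  have hQ0 (l : List 𝒳) := hQ _ (hstrQ l)
  refine ⟨?_, ?_, ?_⟩
  · exact probStopIn_le_rpow_neg (fun l => (hP0 l).1) q₁ p₁
      (fun l => sum_mul_rpow_logb_le_one_of_KL2_minimal hPconv hP (hQ q₁ hq₁) hp₁ (hstrP l)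
        (fun p hp x => hac p hp q₁ hq₁ x) fun p hp => hmin₁ p hp q₁ hq₁) _ _
  · exact probStopIn_mono (fun l => (hQ0 l).1) (fun l => (hQ0 l).2.le) _ fun _ h => h.1
  · exact probStopIn_le_rpow_neg (fun l => (hQ0 l).1) p₀ q₀
      (fun l => sum_mul_rpow_logb_le_one_of_KL2_minimal hQconv hQ (hP p₀ hp₀) hq₀ (hstrQ l)
        (fun q hq x => (hac p₀ hp₀ q hq x).symm) fun q hq => hmin₀ p₀ hp₀ q hq) _ _
end
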